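/- Define, for a unit vector ψ ∈ ℂ²⊗ℂ², the maximal product fidelity F(ψ) = sup over unit vectors a, b ∈ ℂ² of |⟨ψ, a⊗b⟩|², and the Bures entanglement E_B(ψ) = 2·(1 − √F(ψ)). Then for every θ ∈ [0, π], E_B(ψ_S(θ)) = 2·(1 − max(cos(θ/2), sin(θ/2))). -/

import Mathlib

open Matrix Real

noncomputable section

/-- Standard basis vectors of ℂ². -/
def e0 : Fin 2 → ℂ := ![1, 0]
def e1 : Fin 2 → ℂ := ![0, 1]

/-- First-qubit index of a two-qubit basis label, with basis order
`(e₀⊗e₀, e₀⊗e₁, e₁⊗e₀, e₁⊗e₁)`. -/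
def q1 : Fin 4 → Fin 2 := ![0, 0, 1, 1]
/-- Second-qubit index of a two-qubit basis label. -/
def q2 : Fin 4 → Fin 2 := ![0, 1, 0, 1]

/-- Kronecker (tensor) product of two vectors in ℂ², as a vector in ℂ⁴. -/
def vkron (a b : Fin 2 → ℂ) : Fin 4 → ℂ := fun i => a (q1 i) * b (q2 i)

/-- Kronecker product of two 2×2 matrices, as a 4×4 matrix in the basis
`(e₀⊗e₀, e₀⊗e₁, e₁⊗e₀, e₁⊗e₁)`. -/
def mkron (A B : Matrix (Fin 2) (Fin 2) ℂ) : Matrix (Fin 4) (Fin 4) ℂ :=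
  Matrix.of fun i j => A (q1 i) (q1 j) * B (q2 i) (q2 j)

/-- The outer product `|v⟩⟨v|`. -/
def outer (v : Fin 4 → ℂ) : Matrix (Fin 4) (Fin 4) ℂ :=
  Matrix.of fun i j => v i * star (v j)

/-- The two-qubit Schmidt state `ψ_S(θ) = cos(θ/2)·e₀⊗e₀ + sin(θ/2)·e₁⊗e₁`. -/
def psiS (θ : ℝ) : Fin 4 → ℂ :=
  (Real.cos (θ / 2) : ℂ) • vkron e0 e0 + (Real.sin (θ / 2) : ℂ) • vkron e1 e1

/-- The Schmidt density matrix `ρ_S(θ) = |ψ_S(θ)⟩⟨ψ_S(θ)|`. -/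
def rhoS (θ : ℝ) : Matrix (Fin 4) (Fin 4) ℂ := outer (psiS θ)

/-- σ₀, the 2×2 identity. -/
def σ₀ : Matrix (Fin 2) (Fin 2) ℂ := 1
/-- The Pauli matrices σ₁, σ₂, σ₃. -/
def pauli : Fin 3 → Matrix (Fin 2) (Fin 2) ℂ :=
  ![!![0, 1; 1, 0], !![0, -Complex.I; Complex.I, 0], !![1, 0; 0, -1]]

/-- The projector `P` onto the local (single-qubit) part:
`P(X) = (1/4)·Σ_{j=1}^{3} [Tr(X·(σ₀⊗σ_j))·(σ₀⊗σ_j) + Tr(X·(σ_j⊗σ₀))·(σ_j⊗σ₀)]`. -/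
def Pproj (X : Matrix (Fin 4) (Fin 4) ℂ) : Matrix (Fin 4) (Fin 4) ℂ :=
  (1 / 4 : ℂ) • ∑ j : Fin 3,
    ((X * mkron σ₀ (pauli j)).trace • mkron σ₀ (pauli j)
      + (X * mkron (pauli j) σ₀).trace • mkron (pauli j) σ₀)

/-- The matrix commutator. -/
def matComm (X Y : Matrix (Fin 4) (Fin 4) ℂ) : Matrix (Fin 4) (Fin 4) ℂ := X * Y - Y * X

/-- `a ∈ ℂ²` is a unit vector. -/
def unit2 (a : Fin 2 → ℂ) : Prop := ‖a 0‖ ^ 2 + ‖a 1‖ ^ 2 = 1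

/-- The inner product `⟨ψ, v⟩` on ℂ⁴ (conjugate-linear in the first slot). -/
def cinner (ψ v : Fin 4 → ℂ) : ℂ := ∑ i, starRingEnd ℂ (ψ i) * v i

/-- The maximal product fidelity `F(ψ) = sup_{a,b unit} |⟨ψ, a⊗b⟩|²`. -/
def maxFid (ψ : Fin 4 → ℂ) : ℝ :=
  sSup {r : ℝ | ∃ a b : Fin 2 → ℂ, unit2 a ∧ unit2 b ∧ r = ‖cinner ψ (vkron a b)‖ ^ 2}

/-- The Bures entanglement `E_B(ψ) = 2·(1 − √F(ψ))`. -/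
def buresEnt (ψ : Fin 4 → ℂ) : ℝ := 2 * (1 - Real.sqrt (maxFid ψ))

theorem cinner_psiS (θ : ℝ) (a b : Fin 2 → ℂ) :
    cinner (psiS θ) (vkron a b) =
      (Real.cos (θ / 2) : ℂ) * (a 0 * b 0) + (Real.sin (θ / 2) : ℂ) * (a 1 * b 1) := by
  simp only [cinner, Fin.sum_univ_four, psiS, vkron, e0, e1, q1, q2, Pi.add_apply, Pi.smul_apply,
    smul_eq_mul, map_add, map_mul, Complex.conj_ofReal]
  simp [-Complex.ofReal_cos, -Complex.ofReal_sin]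

theorem maxFid_psiS (θ : ℝ) (hc : 0 ≤ Real.cos (θ / 2)) (hs : 0 ≤ Real.sin (θ / 2)) :
    maxFid (psiS θ) = (max (Real.cos (θ / 2)) (Real.sin (θ / 2))) ^ 2 := by
  apply IsGreatest.csSup_eq
  constructor
  · rcases le_total (Real.cos (θ / 2)) (Real.sin (θ / 2)) with h | h
    · refine ⟨e1, e1, by simp [unit2, e1], by simp [unit2, e1], ?_⟩
      rw [cinner_psiS, max_eq_right h]
      simp [e1, -Complex.ofReal_cos, -Complex.ofReal_sin]
    · refine ⟨e0, e0, by simp [unit2, e0], by simp [unit2, e0], ?_⟩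
      rw [cinner_psiS, max_eq_left h]
      simp [e0, -Complex.ofReal_cos, -Complex.ofReal_sin]
  · rintro r ⟨a, b, ha, hb, rfl⟩
    rw [cinner_psiS]
    unfold unit2 at ha hb
    have hm1 := le_max_left (Real.cos (θ / 2)) (Real.sin (θ / 2))
    have hm2 := le_max_right (Real.cos (θ / 2)) (Real.sin (θ / 2))
    generalize max (Real.cos (θ / 2)) (Real.sin (θ / 2)) = m at *
    generalize Real.cos (θ / 2) = c at *
    generalize Real.sin (θ / 2) = s at *
    have h1 : ‖(c : ℂ) * (a 0 * b 0) + (s : ℂ) * (a 1 * b 1)‖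
        ≤ c * (‖a 0‖ * ‖b 0‖) + s * (‖a 1‖ * ‖b 1‖) := by
      refine (norm_add_le _ _).trans (le_of_eq ?_)
      simp [abs_of_nonneg hc, abs_of_nonneg hs]
    have h2 : c * (‖a 0‖ * ‖b 0‖) ≤ m * (‖a 0‖ * ‖b 0‖) := by gcongr
    have h3 : s * (‖a 1‖ * ‖b 1‖) ≤ m * (‖a 1‖ * ‖b 1‖) := by gcongr
    have h4 : ‖a 0‖ * ‖b 0‖ + ‖a 1‖ * ‖b 1‖ ≤ 1 := by
      nlinarith [sq_nonneg (‖a 0‖ - ‖b 0‖), sq_nonneg (‖a 1‖ - ‖b 1‖)]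
    have hm : 0 ≤ m := hc.trans hm1
    have h5 := mul_le_mul_of_nonneg_left h4 hm
    apply pow_le_pow_left₀ (norm_nonneg _)
    linarith

/-- for `θ ∈ [0, π]`,
`E_B(ψ_S(θ)) = 2·(1 − max(cos(θ/2), sin(θ/2)))`. -/
theorem bures_entanglement_of_schmidt (θ : ℝ) (h0 : 0 ≤ θ) (hπ : θ ≤ π) :
    buresEnt (psiS θ) = 2 * (1 - max (Real.cos (θ / 2)) (Real.sin (θ / 2))) := by
  have hc : 0 ≤ Real.cos (θ / 2) :=
    Real.cos_nonneg_of_mem_Icc ⟨by linarith [Real.pi_pos], by linarith⟩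
  have hs : 0 ≤ Real.sin (θ / 2) :=
    Real.sin_nonneg_of_nonneg_of_le_pi (by linarith) (by linarith)
  rw [buresEnt, maxFid_psiS θ hc hs, Real.sqrt_sq (hc.trans (le_max_left _ _))]
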